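/- Let (R, m) be a commutative noetherian local ring with m decomposable (m = I ⊕ J with I, J nonzero ideals), and let M be a finitely generated R-module with projective dimension at least two. Then either I or J is a direct summand of the third syzygy Ω_R³(M). -/

import Mathlib

universe u

/-- A minimal free resolution of the module `M` over `R`, where minimality is
measured with respect to the ideal `𝔪` (the maximal ideal in applications). -/
structure MinFreeRes (R : Type u) [CommRing R] (𝔪 : Ideal R)
    (M : Type u) [AddCommGroup M] [Module R M] : Type u where
  b : ℕ → ℕ
  aug : (Fin (b 0) → R) →ₗ[R] M
  d : ∀ n : ℕ, (Fin (b (n + 1)) → R) →ₗ[R] (Fin (b n) → R)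
  aug_surj : Function.Surjective aug
  exact_aug : LinearMap.range (d 0) = LinearMap.ker aug
  exact : ∀ n, LinearMap.range (d (n + 1)) = LinearMap.ker (d n)
  minimal : ∀ n, LinearMap.range (d n) ≤ 𝔪 • (⊤ : Submodule R (Fin (b n) → R))

namespace MinFreeRes

variable {R : Type u} [CommRing R] {𝔪 : Ideal R}
  {M : Type u} [AddCommGroup M] [Module R M]

/-- The `n`-th syzygy of `M` given by the minimal free resolution `F`:
`Syz 0 = M` and `Syz (n+1) = image of d n = ker of the previous map`. -/
def Syz (F : MinFreeRes R 𝔪 M) : ℕ → Type u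
  | 0 => M
  | n + 1 => ↥(LinearMap.range (F.d n))

instance (F : MinFreeRes R 𝔪 M) : ∀ n, AddCommGroup (F.Syz n)
  | 0 => inferInstanceAs (AddCommGroup M)
  | n + 1 => inferInstanceAs (AddCommGroup ↥(LinearMap.range (F.d n)))

instance (F : MinFreeRes R 𝔪 M) : ∀ n, Module R (F.Syz n)
  | 0 => inferInstanceAs (Module R M)
  | n + 1 => inferInstanceAs (Module R ↥(LinearMap.range (F.d n)))

/-- The Auslander transpose of `M` computed from the minimal free resolution `F`:
the cokernel of the `R`-dual of the first differential. -/
def Tr (F : MinFreeRes R 𝔪 M) : Type u :=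
  (Module.Dual R (Fin (F.b 1) → R)) ⧸ LinearMap.range ((F.d 0).dualMap)

instance (F : MinFreeRes R 𝔪 M) : AddCommGroup F.Tr :=
  inferInstanceAs (AddCommGroup
    ((Module.Dual R (Fin (F.b 1) → R)) ⧸ LinearMap.range ((F.d 0).dualMap)))

instance (F : MinFreeRes R 𝔪 M) : Module R F.Tr :=
  inferInstanceAs (Module R
    ((Module.Dual R (Fin (F.b 1) → R)) ⧸ LinearMap.range ((F.d 0).dualMap)))

/-- `Ext¹_R(M, N)` computed from the minimal free resolution `F` of `M`:
the homology of `Hom(F₀,N) → Hom(F₁,N) → Hom(F₂,N)` in the middle spot. -/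
def Ext1 (F : MinFreeRes R 𝔪 M) (N : Type u) [AddCommGroup N] [Module R N] : Type u :=
  ↥(LinearMap.ker (LinearMap.lcomp R N (F.d 1))) ⧸
    (LinearMap.range (LinearMap.lcomp R N (F.d 0))).comap
      (LinearMap.ker (LinearMap.lcomp R N (F.d 1))).subtype

instance (F : MinFreeRes R 𝔪 M) (N : Type u) [AddCommGroup N] [Module R N] :
    AddCommGroup (F.Ext1 N) :=
  inferInstanceAs (AddCommGroup
    (↥(LinearMap.ker (LinearMap.lcomp R N (F.d 1))) ⧸
      (LinearMap.range (LinearMap.lcomp R N (F.d 0))).comap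
        (LinearMap.ker (LinearMap.lcomp R N (F.d 1))).subtype))

instance (F : MinFreeRes R 𝔪 M) (N : Type u) [AddCommGroup N] [Module R N] :
    Module R (F.Ext1 N) :=
  inferInstanceAs (Module R
    (↥(LinearMap.ker (LinearMap.lcomp R N (F.d 1))) ⧸
      (LinearMap.range (LinearMap.lcomp R N (F.d 0))).comap
        (LinearMap.ker (LinearMap.lcomp R N (F.d 1))).subtype))

end MinFreeRes

/-- `S` is (isomorphic to) a direct summand of `M` as an `R`-module. -/
def IsDirectSummand (R : Type u) [CommRing R] (S M : Type u)
    [AddCommGroup S] [Module R S] [AddCommGroup M] [Module R M] : Prop :=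
  ∃ (i : S →ₗ[R] M) (p : M →ₗ[R] S), p ∘ₗ i = LinearMap.id

/-- `S` belongs to `add X`: it is a direct summand of a finite direct sum of copies of `X`. -/
def InAddClosure (R : Type u) [CommRing R] (S X : Type u)
    [AddCommGroup S] [Module R S] [AddCommGroup X] [Module R X] : Prop :=
  ∃ r : ℕ, IsDirectSummand R S (Fin r → X)

/-- There exists a short exact sequence `0 → A → B → C → 0` of `R`-modules. -/
def ExistsSES (R : Type u) [CommRing R] (A B C : Type u)
    [AddCommGroup A] [Module R A] [AddCommGroup B] [Module R B]
    [AddCommGroup C] [Module R C] : Prop :=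
  ∃ (i : A →ₗ[R] B) (p : B →ₗ[R] C),
    Function.Injective i ∧ Function.Surjective p ∧ LinearMap.range i = LinearMap.ker p

/-- The `R`-module `M` has depth (with respect to the ideal `𝔪`) equal to `t`:
there is an `M`-regular sequence of length `t` in `𝔪` and no longer one. -/
def HasDepth (R : Type u) [CommRing R] (𝔪 : Ideal R) (M : Type u)
    [AddCommGroup M] [Module R M] (t : ℕ) : Prop :=
  (∃ rs : List R, rs.length = t ∧ (∀ x ∈ rs, x ∈ 𝔪) ∧ RingTheory.Sequence.IsRegular M rs) ∧
  ∀ rs : List R, (∀ x ∈ rs, x ∈ 𝔪) → RingTheory.Sequence.IsRegular M rs → rs.length ≤ t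

/-- `𝔪` needs at least (and exactly) `e` generators. -/
def HasMinGens (R : Type u) [CommRing R] (𝔪 : Ideal R) (e : ℕ) : Prop :=
  (∃ s : Finset R, s.card = e ∧ Ideal.span (s : Set R) = 𝔪) ∧
  ∀ s : Finset R, Ideal.span (s : Set R) = 𝔪 → e ≤ s.card

/-- `R` is a regular local ring with maximal ideal `𝔪`: `𝔪` is generated by
`dim R` elements. -/
def IsRegularWrt (R : Type u) [CommRing R] (𝔪 : Ideal R) : Prop :=
  ∃ s : Finset R, Ideal.span (s : Set R) = 𝔪 ∧ (s.card : WithBot ℕ∞) = ringKrullDim R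

/-- The local ring `(R, 𝔪)` of dimension `d` has Hilbert–Samuel multiplicity `e`:
the function `n ↦ length (R / 𝔪^(n+1))` eventually agrees with a polynomial of
degree `d` whose leading coefficient is `e / d!`. -/
def HasHSMultiplicity (R : Type u) [CommRing R] (𝔪 : Ideal R) (d e : ℕ) : Prop :=
  ∃ p : Polynomial ℚ, p.natDegree = d ∧ p.leadingCoeff * (d.factorial : ℚ) = e ∧
    ∀ᶠ n : ℕ in Filter.atTop, ∃ l : ℕ,
      Order.krullDim (Submodule R (R ⧸ 𝔪 ^ (n + 1))) = l ∧ (l : ℚ) = p.eval (n : ℚ)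

theorem exists_linearMap_sup_id_on_left {R N : Type*} [Ring R] [AddCommGroup N] [Module R N]
    {p q : Submodule R N} (h : p ⊓ q = ⊥) :
    ∃ π : ↥(p ⊔ q) →ₗ[R] p, ∀ a : p, π (Submodule.inclusion le_sup_left a) = a := by
  let f : p →ₗ[R] ↥(p ⊔ q) := Submodule.inclusion le_sup_left
  let g : q →ₗ[R] ↥(p ⊔ q) := Submodule.inclusion le_sup_right
  have hb : Function.Bijective (f.coprod g) := by
    refine ⟨(injective_iff_map_eq_zero _).2 ?_, ?_⟩
    · rintro ⟨⟨a, ha⟩, ⟨b, hb⟩⟩ hab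
      have hab' : a + b = 0 := congrArg Subtype.val hab
      have ha0 : a = 0 := by
        have : a ∈ p ⊓ q := ⟨ha, by rw [eq_neg_of_add_eq_zero_left hab']; exact q.neg_mem hb⟩
        simpa [h] using this
      have hb0 : b = 0 := by simpa [ha0] using hab'
      subst ha0 hb0
      rfl
    · rintro ⟨x, hx⟩
      obtain ⟨a, ha, b, hb, rfl⟩ := Submodule.mem_sup.1 hx
      exact ⟨(⟨a, ha⟩, ⟨b, hb⟩), rfl⟩
  let e := LinearEquiv.ofBijective _ hb
  refine ⟨LinearMap.fst R p q ∘ₗ e.symm.toLinearMap, fun a ↦ ?_⟩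
  have : Submodule.inclusion le_sup_left a = e (a, 0) := by
    simp [e, f, LinearEquiv.ofBijective_apply]
  rw [this]
  simp

theorem apply_mem_of_mem_smul_top {R ι : Type*} [CommRing R] {𝔪 : Ideal R} {x : ι → R}
    (hx : x ∈ 𝔪 • (⊤ : Submodule R (ι → R))) (i : ι) : x i ∈ 𝔪 := by
  refine Submodule.smul_induction_on hx (fun a ha y _ ↦ ?_) fun y z hy hz ↦ ?_
  · exact 𝔪.mul_mem_right _ ha
  · exact 𝔪.add_mem hy hz

theorem mem_smul_top_of_forall_apply_mem {R ι : Type*} [CommRing R] [Fintype ι] [DecidableEq ι]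
    {𝔪 : Ideal R} {x : ι → R} (hx : ∀ i, x i ∈ 𝔪) :
    x ∈ 𝔪 • (⊤ : Submodule R (ι → R)) := by
  rw [pi_eq_sum_univ' x]
  exact Submodule.sum_mem _ fun i _ ↦ Submodule.smul_mem_smul (hx i) trivial

/-- A submodule `S` of `𝔪 • Rⁿ` containing `I • v`, for `v` a minimal generator of `Rⁿ`, has `I` as
a direct summand whenever `I` is a direct summand of `𝔪`. -/
theorem isDirectSummand_of_forall_smul_mem {R : Type u} [CommRing R] [IsLocalRing R]
    {I J : Ideal R} (hdisj : I ⊓ J = ⊥) (hsum : I ⊔ J = IsLocalRing.maximalIdeal R) {n : ℕ}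
    {S : Submodule R (Fin n → R)}
    (hS : S ≤ IsLocalRing.maximalIdeal R • (⊤ : Submodule R (Fin n → R)))
    {v : Fin n → R} (hv : v ∉ IsLocalRing.maximalIdeal R • (⊤ : Submodule R (Fin n → R)))
    (hIv : ∀ a ∈ I, a • v ∈ S) : IsDirectSummand R I S := by
  obtain ⟨j, hj⟩ : ∃ j, v j ∉ IsLocalRing.maximalIdeal R := by
    by_contra! h
    exact hv (mem_smul_top_of_forall_apply_mem h)
  obtain ⟨u, hu⟩ : IsUnit (v j) := by simpa using hj
  obtain ⟨π, hπ⟩ := exists_linearMap_sup_id_on_left hdisj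
  let c : S →ₗ[R] ↥(I ⊔ J) := ((LinearMap.proj j).comp S.subtype).codRestrict (I ⊔ J)
    fun x ↦ hsum ▸ apply_mem_of_mem_smul_top (hS x.2) j
  let i : I →ₗ[R] S := ((LinearMap.toSpanSingleton R _ v).comp I.subtype).codRestrict S
    fun a ↦ hIv a a.2
  refine ⟨i, (↑u⁻¹ : R) • π ∘ₗ c, LinearMap.ext fun a ↦ ?_⟩
  have hc : c (i a) = (u : R) • Submodule.inclusion le_sup_left a := by
    apply Subtype.ext
    change (a : R) * v j = u * a
    rw [hu, mul_comm]
  simp only [LinearMap.smul_apply, LinearMap.comp_apply, LinearMap.id_apply, hc, map_smul, hπ,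
    smul_smul, Units.inv_mul, one_smul]

theorem projective_ker_of_projective_ker {R M P Q : Type u} [CommRing R]
    [AddCommGroup M] [Module R M] [AddCommGroup P] [Module R P] [AddCommGroup Q] [Module R Q]
    [Module.Projective R P] [Module.Projective R Q] {f : P →ₗ[R] M} {g : Q →ₗ[R] M}
    (hf : Function.Surjective f) (hg : Function.Surjective g)
    [Module.Projective R (LinearMap.ker g)] : Module.Projective R (LinearMap.ker f) := by
  open CategoryTheory in
  have key {P : Type u} [AddCommGroup P] [Module R P] [Module.Projective R P] {f : P →ₗ[R] M}
      (hf : Function.Surjective f) : Module.Projective R (LinearMap.ker f) ↔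
        HasProjectiveDimensionLT (ModuleCat.of R M) 2 := by
    have hz : f ∘ₗ (LinearMap.ker f).subtype = 0 := LinearMap.comp_ker_subtype f
    let S := ShortComplex.mk (ModuleCat.ofHom (LinearMap.ker f).subtype) (ModuleCat.ofHom f)
      (by rw [← ModuleCat.ofHom_comp, hz]; rfl)
    have hS : S.ShortExact := ModuleCat.shortComplex_shortExact S
      (LinearMap.exact_subtype_ker_map f) (LinearMap.ker f).subtype_injective hf
    rw [IsProjective.iff_projective, projective_iff_hasProjectiveDimensionLT_one]
    exact (hS.hasProjectiveDimensionLT_X₃_iff 0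
      ((IsProjective.iff_projective P).1 inferInstance)).symm
  exact (key hf).2 ((key hg).1 inferInstance)

theorem ker_eq_bot_of_projective_range {R P Q : Type*} [CommRing R] [IsNoetherianRing R]
    [IsLocalRing R] [AddCommGroup P] [Module R P] [AddCommGroup Q] [Module R Q]
    [Module.Finite R P] (f : P →ₗ[R] Q) [Module.Projective R (LinearMap.range f)]
    (hf : LinearMap.ker f ≤ IsLocalRing.maximalIdeal R • (⊤ : Submodule R P)) :
    LinearMap.ker f = ⊥ := by
  obtain ⟨s, hs⟩ := Module.projective_lifting_property f.rangeRestrict LinearMap.id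
    f.surjective_rangeRestrict
  have hfs : ∀ y, f (s y) = y := fun y ↦ congrArg Subtype.val (LinearMap.congr_fun hs y)
  let e : P →ₗ[R] P := LinearMap.id - s ∘ₗ f.rangeRestrict
  have he : (⊤ : Submodule R P).map e ≤ LinearMap.ker f := by
    rintro _ ⟨x, -, rfl⟩
    simp [e, hfs]
  have heK : LinearMap.ker f ≤ (LinearMap.ker f).map e := by
    intro x hx
    have : f.rangeRestrict x = 0 := Subtype.ext hx
    exact ⟨x, hx, by simp [e, this]⟩
  refine Submodule.eq_bot_of_le_smul_of_le_jacobson_bot (IsLocalRing.maximalIdeal R) _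
    (IsNoetherian.noetherian _) ?_ (IsLocalRing.maximalIdeal_le_jacobson _)
  calc LinearMap.ker f ≤ (LinearMap.ker f).map e := heK
    _ ≤ (IsLocalRing.maximalIdeal R • (⊤ : Submodule R P)).map e := Submodule.map_mono hf
    _ = IsLocalRing.maximalIdeal R • (⊤ : Submodule R P).map e := Submodule.map_smul'' _ _ _
    _ ≤ IsLocalRing.maximalIdeal R • LinearMap.ker f := Submodule.smul_mono le_rfl he

/-- Vanishing of the second syzygy does not depend on the minimal free resolution. -/
theorem MinFreeRes.range_d_one_eq_bot {R : Type u} [CommRing R] [IsNoetherianRing R]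
    [IsLocalRing R] {M : Type u} [AddCommGroup M] [Module R M]
    (F F' : MinFreeRes R (IsLocalRing.maximalIdeal R) M) (h : LinearMap.range (F.d 1) = ⊥) :
    LinearMap.range (F'.d 1) = ⊥ := by
  have hinj : Function.Injective (F.d 0) := LinearMap.ker_eq_bot.1 (F.exact 0 ▸ h)
  have : Module.Projective R (LinearMap.ker F.aug) := by
    rw [← F.exact_aug]
    exact Module.Projective.of_equiv (LinearEquiv.ofInjective _ hinj)
  have : Module.Projective R (LinearMap.range (F'.d 0)) := by
    rw [F'.exact_aug]
    exact projective_ker_of_projective_ker F'.aug_surj F.aug_surj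
  rw [F'.exact 0]
  exact ker_eq_bot_of_projective_range _ (F'.exact 0 ▸ F'.minimal 1)

/-- When `𝔪 = I ⊕ J`, a nonzero second syzygy has a minimal generator killed by `I` or by `J`. -/
theorem exists_mem_ker_notMem_smul {R : Type*} [CommRing R] [IsNoetherianRing R] [IsLocalRing R]
    {I J : Ideal R} (hdisj : I ⊓ J = ⊥) (hsum : I ⊔ J = IsLocalRing.maximalIdeal R) {m n : ℕ}
    (f : (Fin n → R) →ₗ[R] (Fin m → R))
    (hK : LinearMap.ker f ≤ IsLocalRing.maximalIdeal R • (⊤ : Submodule R (Fin n → R)))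
    (hne : LinearMap.ker f ≠ ⊥) :
    ∃ w ∈ LinearMap.ker f, w ∉ IsLocalRing.maximalIdeal R • LinearMap.ker f ∧
      ((∀ a ∈ I, a • w = 0) ∨ ∀ b ∈ J, b • w = 0) := by
  have hIJ : ∀ a ∈ I, ∀ b ∈ J, a * b = 0 := fun a ha b hb ↦ by
    have : a * b ∈ I ⊓ J := ⟨I.mul_mem_right _ ha, J.mul_mem_left _ hb⟩
    simpa [hdisj] using this
  have kill : ∀ {n : ℕ} {A B : Ideal R}, (∀ a ∈ A, ∀ b ∈ B, a * b = 0) → ∀ a ∈ A,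
      ∀ x ∈ B • (⊤ : Submodule R (Fin n → R)), a • x = 0 := fun h a ha x hx ↦
    funext fun i ↦ h a ha _ (apply_mem_of_mem_smul_top hx i)
  have hJI : ∀ b ∈ J, ∀ a ∈ I, b * a = 0 := fun b hb a ha ↦ by rw [mul_comm, hIJ a ha b hb]
  have himage : ∀ (A : Ideal R), ∀ x ∈ A • (⊤ : Submodule R (Fin n → R)),
      ∀ i, f x i ∈ A := fun A x hx i ↦ by
    have := Submodule.mem_map_of_mem (f := f) hx
    rw [Submodule.map_smul''] at this
    exact apply_mem_of_mem_smul_top (Submodule.smul_mono le_rfl le_top this) i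
  by_contra! hcon
  refine hne (Submodule.eq_bot_of_le_smul_of_le_jacobson_bot (IsLocalRing.maximalIdeal R) _
    (IsNoetherian.noetherian _) (fun w hw ↦ ?_) (IsLocalRing.maximalIdeal_le_jacobson _))
  have hw' := hK hw
  rw [← hsum, Submodule.sup_smul] at hw'
  obtain ⟨x, hx, y, hy, rfl⟩ := Submodule.mem_sup.1 hw'
  have hxy : f x = 0 ∧ f y = 0 := by
    have hadd : f x + f y = 0 := by rw [← map_add]; exact hw
    have hx0 : f x = 0 := by
      funext i
      have : f x i ∈ I ⊓ J := by
        refine ⟨himage I x hx i, ?_⟩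
        rw [eq_neg_of_add_eq_zero_left hadd]
        exact J.neg_mem (himage J y hy i)
      simpa [hdisj] using this
    exact ⟨hx0, by simpa [hx0] using hadd⟩
  have hx' : x ∈ IsLocalRing.maximalIdeal R • LinearMap.ker f := by
    by_contra h
    obtain ⟨-, b, hb, hbx⟩ := hcon x hxy.1 h
    exact hbx (kill hJI b hb x hx)
  have hy' : y ∈ IsLocalRing.maximalIdeal R • LinearMap.ker f := by
    by_contra h
    obtain ⟨⟨a, ha, hay⟩, -⟩ := hcon y hxy.2 h
    exact hay (kill hIJ a ha y hy)
  exact add_mem hx' hy'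

/-- if `𝔪 = I ⊕ J` with `I, J` nonzero ideals and `M` has projective
dimension at least two, then `I` or `J` is a direct summand of `Ω_R³(M)`. -/
theorem stmt8 (R : Type u) [CommRing R] [IsNoetherianRing R] [IsLocalRing R]
    (I J : Ideal R) (hI : I ≠ ⊥) (hJ : J ≠ ⊥)
    (hdisj : I ⊓ J = ⊥) (hsum : I ⊔ J = IsLocalRing.maximalIdeal R)
    (M : Type u) [AddCommGroup M] [Module R M] [Module.Finite R M]
    (hpd : ∃ F : MinFreeRes R (IsLocalRing.maximalIdeal R) M, Nontrivial (F.Syz 2)) :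
    ∀ F : MinFreeRes R (IsLocalRing.maximalIdeal R) M,
      IsDirectSummand R ↥I (F.Syz 3) ∨ IsDirectSummand R ↥J (F.Syz 3) := by
  intro F
  obtain ⟨F₀, hF₀⟩ := hpd
  have hne : LinearMap.ker (F.d 0) ≠ ⊥ := fun h ↦ by
    have hbot := F.range_d_one_eq_bot F₀ ((F.exact 0).trans h)
    have : Nontrivial ↥(LinearMap.range (F₀.d 1)) := hF₀
    exact (Submodule.nontrivial_iff_ne_bot.1 this) hbot
  obtain ⟨w, hw, hw', hIJ⟩ := exists_mem_ker_notMem_smul hdisj hsum (F.d 0)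
    (F.exact 0 ▸ F.minimal 1) hne
  rw [← F.exact 0] at hw hw'
  obtain ⟨v, rfl⟩ := hw
  have hv : v ∉ IsLocalRing.maximalIdeal R • (⊤ : Submodule R (Fin (F.b 2) → R)) := fun h ↦ by
    have := Submodule.mem_map_of_mem (f := F.d 1) h
    rw [Submodule.map_smul'', Submodule.map_top] at this
    exact hw' this
  have hmem : ∀ a : R, a • F.d 1 v = 0 → a • v ∈ LinearMap.range (F.d 2) := fun a ha ↦ by
    rw [F.exact 1, LinearMap.mem_ker, map_smul, ha]
  rcases hIJ with h | h
  · exact Or.inl (isDirectSummand_of_forall_smul_mem hdisj hsum (F.minimal 2) hv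
      fun a ha ↦ hmem a (h a ha))
  · exact Or.inr (isDirectSummand_of_forall_smul_mem (inf_comm I J ▸ hdisj)
      (sup_comm I J ▸ hsum) (F.minimal 2) hv fun a ha ↦ hmem a (h a ha))
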